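/- Let j be an even positive integer that is neither equal to 6 nor a power of two. Then the polynomial φ_j(x,y,z) over F_2 has an absolutely irreducible factor over F_2. -/

import Mathlib

/-- The denominator `(x+y)(x+z)(y+z)` as a polynomial in the variables
`x = X 0`, `y = X 1`, `z = X 2`. -/
noncomputable def denom (F : Type*) [Field F] : MvPolynomial (Fin 3) F :=
  (MvPolynomial.X 0 + MvPolynomial.X 1) * (MvPolynomial.X 0 + MvPolynomial.X 2) *
    (MvPolynomial.X 1 + MvPolynomial.X 2)

/-- The numerator `x(f(y)+f(z)) + y(f(x)+f(z)) + z(f(x)+f(y))` of `Φ_f`;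
`Φ_f` is the (exact) quotient of `numer F f` by `denom F`. -/
noncomputable def numer (F : Type*) [Field F] (f : Polynomial F) : MvPolynomial (Fin 3) F :=
  MvPolynomial.X 0 *
      (Polynomial.aeval (MvPolynomial.X 1) f + Polynomial.aeval (MvPolynomial.X 2) f) +
    MvPolynomial.X 1 *
      (Polynomial.aeval (MvPolynomial.X 0) f + Polynomial.aeval (MvPolynomial.X 2) f) +
    MvPolynomial.X 2 *
      (Polynomial.aeval (MvPolynomial.X 0) f + Polynomial.aeval (MvPolynomial.X 1) f)

/-- The numerator `x(y^j+z^j) + y(x^j+z^j) + z(x^j+y^j)` of `φ_j`;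
`φ_j` is the (exact) quotient of `numerMon F j` by `denom F`. -/
noncomputable def numerMon (F : Type*) [Field F] (j : ℕ) : MvPolynomial (Fin 3) F :=
  MvPolynomial.X 0 * (MvPolynomial.X 1 ^ j + MvPolynomial.X 2 ^ j) +
    MvPolynomial.X 1 * (MvPolynomial.X 0 ^ j + MvPolynomial.X 2 ^ j) +
    MvPolynomial.X 2 * (MvPolynomial.X 0 ^ j + MvPolynomial.X 1 ^ j)

/-- A polynomial over `F` has an absolutely irreducible factor over `F` if it has a
nonconstant factor with coefficients in `F` that stays irreducible over the algebraic
closure of `F`. -/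
def HasAbsIrredFactor (F : Type*) [Field F] (P : MvPolynomial (Fin 3) F) : Prop :=
  ∃ g : MvPolynomial (Fin 3) F, g ∣ P ∧ 0 < g.totalDegree ∧
    Irreducible (MvPolynomial.map (algebraMap F (AlgebraicClosure F)) g)

section aux
open Polynomial Polynomial.Bivariate


/-- Partial derivative with respect to the inner variable. -/
noncomputable def dZ {K : Type*} [Field K] (F : K[X][X]) : K[X][X] :=
  Bivariate.swap (derivative (Bivariate.swap F))

section dZ
variable {K : Type*} [Field K]

lemma dZ_add (F G : K[X][X]) : dZ (F + G) = dZ F + dZ G := by simp [dZ]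
lemma dZ_mul (F G : K[X][X]) : dZ (F * G) = dZ F * G + F * dZ G := by
  simp [dZ, Bivariate.swap_swap_apply]
lemma dZ_C (p : K[X]) : dZ (C p) = C (derivative p) := by
  simp only [dZ, Bivariate.swap_C, derivative_map, Bivariate.swap_map_C]
lemma dZ_X : dZ (X : K[X][X]) = 0 := by
  have : Bivariate.swap (X : K[X][X]) = C X := Bivariate.swap_Y
  simp [dZ, this]
lemma dZ_map_C (p : K[X]) : dZ (p.map C) = 0 := by
  simp only [dZ, Bivariate.swap_map_C, derivative_C, map_zero]

lemma chain_rule {A M : Type*} [CommRing A] [Algebra K A] [AddCommGroup M] [Module A M]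
    [Module K M] (D : Derivation K A M) (π : K[X][X] →ₐ[K] A)
    (F : K[X][X]) :
    D (π F) = π (dZ F) • D (π (C X)) + π (derivative F) • D (π X) := by
  have h1 : ∀ p : K[X], D (π (C p)) = π (C (derivative p)) • D (π (C X)) := by
    intro p
    induction p using Polynomial.induction_on' with
    | add p q hp hq => simp only [map_add, hp, hq, add_smul]
    | monomial n a =>
      have : (C (monomial n a) : K[X][X]) = algebraMap K K[X][X] a * (C X) ^ n := by
        rw [← C_mul_X_pow_eq_monomial, C_mul, C_pow]; rfl
      have h2 : (C (derivative (monomial n a)) : K[X][X])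
          = algebraMap K K[X][X] a * ((n : K[X][X]) * (C X) ^ (n - 1)) := by
        rw [derivative_monomial, ← C_mul_X_pow_eq_monomial]
        simp only [C_mul, C_pow, map_natCast, mul_assoc]; rfl
      rw [this, h2, map_mul π, map_pow π, π.commutes, D.leibniz, D.map_algebraMap,
        D.leibniz_pow, smul_zero, add_zero, map_mul π, π.commutes, map_mul π, map_pow π, map_natCast π,
        ← Nat.cast_smul_eq_nsmul A, smul_smul, smul_smul, mul_assoc]
  induction F using Polynomial.induction_on with
  | C p => rw [h1, dZ_C, derivative_C, map_zero, zero_smul, add_zero]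
  | add p q hp hq =>
    rw [map_add, map_add, hp, hq, dZ_add, derivative_add, map_add, map_add, add_smul, add_smul]
    abel
  | monomial n a ih =>
    rw [pow_succ, ← mul_assoc, map_mul, D.leibniz, ih, dZ_mul (C a * X ^ n) X, dZ_X,
      derivative_mul (f := C a * X ^ n)]
    simp only [smul_add, smul_smul, add_smul, derivative_X, mul_zero, add_zero, mul_one,
      map_add, map_mul]
    rw [mul_comm (π X) (π (dZ _)), mul_comm (π X) (π (derivative _))]
    abel
end dZ

theorem finrank_le_aux {K A : Type*} [Field K] [IsAlgClosed K] [CommRing A] [Algebra K A]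
    (π : K[X][X] →ₐ[K] A) (hπ : Function.Surjective π) (G H W : K[X][X])
    (hG : π G = 0) (hH : π H = 0)
    (hJ' : π W * (π (dZ G) * π (derivative H) - π (derivative G) * π (dZ H)) = 1)
    (S : Finset (K × K))
    (hS : ∀ z y, evalEval z y G = 0 → evalEval z y H = 0 → (z, y) ∈ S) :
    Module.Finite K A ∧ Module.finrank K A ≤ S.card := by
  have hunr : Algebra.FormallyUnramified K A := by
    constructor
    let D0 := KaehlerDifferential.D K A
    have h0 : ∀ F, D0 (π F) = π (dZ F) • D0 (π (C X)) + π (derivative F) • D0 (π X) := by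
      intro F
      exact chain_rule D0 π F
    have eG := h0 G
    have eH := h0 H
    rw [hG, map_zero] at eG
    rw [hH, map_zero] at eH
    have z1 : D0 (π (C X)) = 0 := by
      rw [← one_smul A (D0 (π (C X))), ← hJ']
      have : (π W * (π (dZ G) * π (derivative H) - π (derivative G) * π (dZ H))) • D0 (π (C X))
        = (π W * π (derivative H)) • (π (dZ G) • D0 (π (C X)) + π (derivative G) • D0 (π X))
         - (π W * π (derivative G)) • (π (dZ H) • D0 (π (C X)) + π (derivative H) • D0 (π X)) := by
        module
      rw [this, ← eG, ← eH]; simp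
    have z2 : D0 (π X) = 0 := by
      rw [← one_smul A (D0 (π X)), ← hJ']
      have : (π W * (π (dZ G) * π (derivative H) - π (derivative G) * π (dZ H))) • D0 (π X)
        = (π W * π (dZ G)) • (π (dZ H) • D0 (π (C X)) + π (derivative H) • D0 (π X))
         - (π W * π (dZ H)) • (π (dZ G) • D0 (π (C X)) + π (derivative G) • D0 (π X)) := by
        module
      rw [this, ← eG, ← eH]; simp
    have hz : ∀ a, D0 a = 0 := by
      intro a
      obtain ⟨F, rfl⟩ := hπ a
      rw [h0, z1, z2, smul_zero, smul_zero, add_zero]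
    have htop := KaehlerDifferential.span_range_derivation K A
    have : Set.range (KaehlerDifferential.D K A) ⊆ {0} := by
      rintro _ ⟨a, rfl⟩; exact hz a
    have h2 : (⊤ : Submodule A Ω[A⁄K]) ≤ ⊥ := by
      rw [← htop, Submodule.span_le]; exact this
    exact (Submodule.subsingleton_iff A).1 (subsingleton_of_bot_eq_top (le_antisymm bot_le h2))
  have hft : Algebra.FiniteType K A := Algebra.FiniteType.of_surjective π hπ
  have hes : Algebra.EssFiniteType K A := inferInstance
  have het : Algebra.FormallyEtale K A := Algebra.FormallyEtale.of_formallyUnramified_of_field K A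
  have hfin : Module.Finite K A := Algebra.FormallyUnramified.finite_of_free K A
  refine ⟨hfin, ?_⟩
  have hart : IsArtinianRing A := isArtinian_of_tower K inferInstance
  let e := Algebra.FormallyEtale.equivPiOfIsSepClosed K A
  have : Finite (PrimeSpectrum A) := inferInstance
  have := Fintype.ofFinite (PrimeSpectrum A)
  have hfr : Module.finrank K A = Fintype.card (PrimeSpectrum A) := by
    rw [e.toLinearEquiv.finrank_eq, Module.finrank_pi]
  rw [hfr, ← Fintype.card_coe S]
  let f : PrimeSpectrum A → (A →ₐ[K] K) := fun p => (Pi.evalAlgHom K (fun _ => K) p).comp e.toAlgHom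
  have hf : ∀ p F, f p (π F) = evalEval (f p (π (C X))) (f p (π X)) F := by
    intro p F
    have : (f p).comp π = aevalAeval (f p (π (C X))) (f p (π X)) := by
      apply (aevalAevalEquiv K K).symm.injective
      simp [aevalAevalEquiv]
    rw [← coe_aevalAeval_eq_evalEval, ← this]; rfl
  refine Fintype.card_le_of_injective (fun p => ⟨(f p (π (C X)), f p (π X)), ?_⟩) ?_
  · apply hS
    · rw [← hf, hG, map_zero]
    · rw [← hf, hH, map_zero]
  · intro p p' h
    simp only [Subtype.mk.injEq, Prod.mk.injEq] at h
    by_contra hne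
    classical
    obtain ⟨F, hF⟩ := hπ (e.symm (Pi.single p 1))
    have h1 := hf p F
    have h2 := hf p' F
    rw [h.1, h.2, ← h2, hF] at h1
    simp [f, Ne.symm hne] at h1


section theta
variable {K : Type*} [Field K]

/-- The substitution `Y ↦ η Z ^ q`, with `Z` as new main variable. -/
noncomputable def theta (q : ℕ) : K[X][X] →+* K[X][X] :=
  eval₂RingHom (mapRingHom C) (C X * X ^ q)

lemma theta_C (q : ℕ) (p : K[X]) : theta q (C p) = p.map C := by simp [theta]
lemma theta_X (q : ℕ) : theta q (X : K[X][X]) = C X * X ^ q := by simp [theta]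

lemma theta_coeff (q : ℕ) (F : K[X][X]) (n k : ℕ) :
    ((theta q F).coeff n).coeff k = if q * k ≤ n then (F.coeff k).coeff (n - q * k) else 0 := by
  induction F using Polynomial.induction_on' with
  | add p r hp hr =>
    rw [map_add, coeff_add, coeff_add, hp, hr, coeff_add, coeff_add]
    split_ifs <;> simp
  | monomial m a =>
    have : theta q (monomial m a) = (a.map C * C (X ^ m)) * X ^ (q * m) := by
      rw [← C_mul_X_pow_eq_monomial, map_mul, map_pow, theta_C, theta_X, mul_pow, ← pow_mul, C_pow]
      ring
    rw [this, coeff_mul_X_pow', coeff_monomial]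
    by_cases hkm : m = k
    · subst hkm
      rw [if_pos rfl]
      split_ifs with h
      · rw [coeff_mul_C, coeff_map, coeff_C_mul, coeff_X_pow]; simp
      · simp
    · rw [if_neg hkm]
      split_ifs with h h'
      · rw [coeff_mul_C, coeff_map, coeff_C_mul, coeff_X_pow, if_neg (Ne.symm hkm)]; simp
      · rw [coeff_mul_C, coeff_map, coeff_C_mul, coeff_X_pow, if_neg (Ne.symm hkm)]; simp
      · simp
      · simp

lemma theta_inj (q : ℕ) {F : K[X][X]} (h : theta q F = 0) : F = 0 := by
  ext k n
  have := theta_coeff q F (n + q * k) k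
  rw [h] at this
  simpa using this.symm

lemma theta_lc_natDegree_le (q : ℕ) (F : K[X][X]) :
    (theta q F).leadingCoeff.natDegree ≤ F.natDegree := by
  rw [natDegree_le_iff_coeff_eq_zero]
  intro k hk
  rw [leadingCoeff, theta_coeff, coeff_eq_zero_of_natDegree_lt hk]
  simp

/-- Polynomials of `Y`-degree less than `s` and weight at most `N`. -/
def Wsp (K : Type*) [Field K] (q s N : ℕ) : Submodule K K[X][X] where
  carrier := {F | ∀ k n, (s ≤ k ∨ N < n + q * k) → (F.coeff k).coeff n = 0}
  add_mem' := by
    intro a b ha hb k n h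
    simp [ha k n h, hb k n h]
  zero_mem' := by intro k n _; simp
  smul_mem' := by
    intro c a ha k n h
    simp [ha k n h]

lemma mem_Wsp {q s N : ℕ} {F : K[X][X]} :
    F ∈ Wsp K q s N ↔ ∀ k n, (s ≤ k ∨ N < n + q * k) → (F.coeff k).coeff n = 0 := Iff.rfl

lemma mem_Wsp_iff {q s N : ℕ} {F : K[X][X]} :
    F ∈ Wsp K q s N ↔ F.degree < s ∧ (theta q F).natDegree ≤ N := by
  rw [mem_Wsp, degree_lt_iff_coeff_zero, natDegree_le_iff_coeff_eq_zero]
  constructor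
  · intro h
    refine ⟨fun m hm => ?_, fun n hn => ?_⟩
    · ext n; simpa using h m n (Or.inl (by exact_mod_cast hm))
    · ext k
      rw [theta_coeff]
      split_ifs with h1
      · simpa using h k (n - q * k) (Or.inr (by omega))
      · simp
  · rintro ⟨h1, h2⟩ k n (h | h)
    · rw [h1 k (by exact_mod_cast h)]; simp
    · have := theta_coeff q F (n + q * k) k
      rw [h2 _ h] at this
      simpa using this.symm

/-- Coordinates on `Wsp`. -/
noncomputable def WspEquiv (q s N : ℕ) :
    Wsp K q s N ≃ₗ[K] (Π k : Fin s, degreeLT K (N + 1 - q * (k : ℕ))) where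
  toFun F := fun k => ⟨F.1.coeff k, by
    rw [mem_degreeLT, degree_lt_iff_coeff_zero]
    intro n hn
    exact F.2 k n (Or.inr (by omega))⟩
  map_add' := by intro a b; ext; simp
  map_smul' := by intro a b; ext; simp
  invFun p := ⟨∑ k : Fin s, C (p k).1 * X ^ (k : ℕ), by
    intro k n h
    simp only [finsetSum_coeff, coeff_C_mul, coeff_X_pow]
    apply Finset.sum_eq_zero
    intro i _
    by_cases hki : k = i
    · have h2 := (p i).2
      rw [mem_degreeLT, degree_lt_iff_coeff_zero] at h2
      have := i.2
      simp only [hki, if_true, mul_one]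
      exact h2 n (by rw [hki] at h; omega)
    · simp [hki]⟩
  left_inv := by
    intro F
    apply Subtype.ext
    ext k n
    simp only [finsetSum_coeff, coeff_C_mul, coeff_X_pow]
    by_cases hk : k < s
    · rw [Finset.sum_eq_single ⟨k, hk⟩]
      · simp
      · intro b _ hb
        have : k ≠ b := fun h => hb (Fin.ext h.symm)
        simp [this]
      · simp
    · rw [F.2 k n (Or.inl (by omega))]
      apply Finset.sum_eq_zero
      intro i _
      have : k ≠ i := by have := i.2; omega
      simp [this]
  right_inv := by
    intro p
    funext i
    apply Subtype.ext
    simp only [finsetSum_coeff, coeff_C_mul, coeff_X_pow]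
    rw [Finset.sum_eq_single i]
    · simp
    · intro b _ hb
      have : (i : ℕ) ≠ b := fun h => hb (Fin.ext h.symm)
      simp [this]
    · simp

instance (q s N : ℕ) : Module.Finite K (Wsp K q s N) :=
  have (m : ℕ) : Module.Finite K (degreeLT K m) := Module.Finite.equiv (degreeLTEquiv K m).symm
  Module.Finite.equiv (WspEquiv q s N).symm

lemma finrank_Wsp (q s N : ℕ) (h : q * s ≤ N) :
    2 * Module.finrank K (Wsp K q s N) + q * s * s = 2 * s * (N + 1) + q * s := by
  have (m : ℕ) : Module.Finite K (degreeLT K m) := Module.Finite.equiv (degreeLTEquiv K m).symm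
  have hd (m : ℕ) : Module.finrank K (degreeLT K m) = m := by
    rw [(degreeLTEquiv K m).finrank_eq]; simp
  rw [(WspEquiv q s N).finrank_eq, Module.finrank_pi_fintype]
  simp only [hd]
  rw [Fin.sum_univ_eq_sum_range (fun k => N + 1 - q * k)]
  induction s with
  | zero => simp
  | succ s ih =>
    have h1 : q * s ≤ N := le_trans (Nat.mul_le_mul_left q (Nat.le_succ s)) h
    have ih := ih h1
    rw [Finset.sum_range_succ]
    obtain ⟨r, hr⟩ := Nat.exists_eq_add_of_le h1
    have : N + 1 - q * s = r + 1 := by omega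
    rw [this]
    have h3 : N + 1 = q * s + r + 1 := by omega
    rw [h3] at ih ⊢
    nlinarith [ih]

lemma reduce_deg {R : Type*} [CommRing R] [IsDomain R] {G H F : R[X]} (hG : G ≠ 0) (hH : H ≠ 0)
    (hc : IsCoprime G.leadingCoeff H.leadingCoeff)
    (hF : F.degree < (G.natDegree + H.natDegree : ℕ)) :
    ∀ n : ℕ, ∀ U V : R[X], U.natDegree < H.natDegree + n → F = U * G + V * H →
      ∃ U V : R[X], U.degree < H.natDegree ∧ V.degree < G.natDegree ∧ F = U * G + V * H := by
  have key : ∀ U V : R[X], U.degree < H.natDegree → F = U * G + V * H →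
      V.degree < G.natDegree := by
    intro U V hU h
    have h1 : V * H = F - U * G := by rw [h]; ring
    have h2 : (V * H).degree < (G.natDegree + H.natDegree : ℕ) := by
      rw [h1]
      refine lt_of_le_of_lt (degree_sub_le _ _) (max_lt hF ?_)
      rw [degree_mul, degree_eq_natDegree hG, Nat.cast_add, add_comm (G.natDegree : WithBot ℕ)]
      exact WithBot.add_lt_add_right (by simp) hU
    rw [degree_mul, degree_eq_natDegree hH, Nat.cast_add] at h2
    exact lt_of_add_lt_add_right h2
  intro n
  induction n with
  | zero =>
    intro U V hU h
    have hU' : U.degree < H.natDegree := lt_of_le_of_lt degree_le_natDegree (by exact_mod_cast hU)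
    exact ⟨U, V, hU', key U V hU' h, h⟩
  | succ n ih =>
    intro U V hU h
    by_cases hlt : U.natDegree < H.natDegree + n
    · exact ih U V hlt h
    have hUd : U.natDegree = H.natDegree + n := by omega
    by_cases hU0 : U = 0
    · exact ⟨U, V, by simp [hU0, bot_lt_iff_ne_bot], key U V (by simp [hU0, bot_lt_iff_ne_bot]) h, h⟩
    have hcoef : (U * G).coeff (H.natDegree + n + G.natDegree)
        + (V * H).coeff (H.natDegree + n + G.natDegree) = 0 := by
      rw [← coeff_add, ← h]
      apply coeff_eq_zero_of_degree_lt
      refine lt_of_lt_of_le hF ?_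
      exact_mod_cast (by omega)
    have hVd : V.natDegree ≤ n + G.natDegree := by
      by_cases hV0 : V = 0
      · simp [hV0]
      have h1 : V * H = F - U * G := by rw [h]; ring
      have h2 : (V * H).natDegree ≤ H.natDegree + n + G.natDegree := by
        rw [h1]
        refine (natDegree_sub_le _ _).trans (max_le ?_ ?_)
        · refine natDegree_le_of_degree_le (le_of_lt (lt_of_lt_of_le hF ?_))
          exact_mod_cast (by omega)
        · rw [natDegree_mul hU0 hG, hUd]
      rw [natDegree_mul hV0 hH] at h2
      omega
    have e1 : (U * G).coeff (H.natDegree + n + G.natDegree) = U.leadingCoeff * G.leadingCoeff := by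
      rw [← hUd, coeff_mul_degree_add_degree]
    have e2 : (V * H).coeff (H.natDegree + n + G.natDegree)
        = V.coeff (n + G.natDegree) * H.leadingCoeff := by
      rw [show H.natDegree + n + G.natDegree = (n + G.natDegree) + H.natDegree by ring,
        coeff_mul_add_eq_of_natDegree_le hVd le_rfl, coeff_natDegree]
    rw [e1, e2] at hcoef
    have hdvd : H.leadingCoeff ∣ U.leadingCoeff * G.leadingCoeff :=
      ⟨-V.coeff (n + G.natDegree), by linear_combination hcoef⟩
    obtain ⟨w, hw⟩ := hc.symm.dvd_of_dvd_mul_right hdvd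
    have hw0 : w ≠ 0 := by rintro rfl; simp at hw; exact hU0 hw
    have hQd : (C w * X ^ n * H).natDegree = H.natDegree + n := by
      rw [natDegree_mul (by simp [hw0]) hH, natDegree_C_mul_X_pow n w hw0, add_comm]
    have hQl : (C w * X ^ n * H).leadingCoeff = U.leadingCoeff := by
      rw [leadingCoeff_mul, leadingCoeff_C_mul_X_pow, hw, mul_comm]
    by_cases hz : H.natDegree + n = 0
    · have hn : n = 0 := by omega
      have hh : H.natDegree = 0 := by omega
      have : U - C w * X ^ n * H = 0 := by
        rw [eq_C_of_natDegree_eq_zero (hUd.trans hz)]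
        rw [eq_C_of_natDegree_eq_zero hh] at hw ⊢
        rw [eq_C_of_natDegree_eq_zero (hUd.trans hz)] at hw
        simp only [leadingCoeff_C] at hw
        rw [hw, hn]; simp [mul_comm]
      refine ⟨0, V + C w * X ^ n * G, by simp [bot_lt_iff_ne_bot], ?_, ?_⟩
      · apply key 0 _ (by simp [bot_lt_iff_ne_bot])
        rw [h]; linear_combination G * this
      · rw [h]; linear_combination G * this
    · refine ih (U - C w * X ^ n * H) (V + C w * X ^ n * G) ?_ (by rw [h]; ring)
      have hdeg : (U - C w * X ^ n * H).degree < U.degree := by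
        apply degree_sub_lt_left _ hU0 hQl.symm
        rw [degree_eq_natDegree hU0, degree_eq_natDegree, hUd, hQd]
        intro h0; rw [h0] at hQl; simp at hQl; exact hU0 (leadingCoeff_eq_zero.1 hQl.symm)
      by_cases h0 : U - C w * X ^ n * H = 0
      · rw [h0]; simp; omega
      · have := natDegree_lt_natDegree h0 hdeg
        omega

lemma theta_weight {q : ℕ} {G H U V : K[X][X]} {N : ℕ} (hG : G ≠ 0) (hH : H ≠ 0)
    (hθ : IsCoprime (theta q G).leadingCoeff (theta q H).leadingCoeff)
    (hs : (theta q G).leadingCoeff.natDegree = G.natDegree)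
    (hV : V.degree < G.natDegree) (hN : (theta q (U * G + V * H)).natDegree ≤ N) :
    (theta q (V * H)).natDegree ≤ N := by
  by_contra hcon
  push Not at hcon
  have hV0 : V ≠ 0 := by rintro rfl; simp at hcon
  have hVθ : theta q V ≠ 0 := fun h => hV0 (theta_inj q h)
  have hGθ : theta q G ≠ 0 := fun h => hG (theta_inj q h)
  have hHθ : theta q H ≠ 0 := fun h => hH (theta_inj q h)
  have hsum : theta q (U * G) = theta q (U * G + V * H) - theta q (V * H) := by
    rw [map_add]; ring
  have hdlt : (theta q (U * G + V * H)).degree < (theta q (V * H)).degree := by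
    apply degree_lt_degree; omega
  have hlc : (theta q (U * G)).leadingCoeff = - (theta q (V * H)).leadingCoeff := by
    rw [hsum, sub_eq_add_neg, leadingCoeff_add_of_degree_lt, leadingCoeff_neg]
    rwa [degree_neg]
  rw [map_mul, map_mul, leadingCoeff_mul, leadingCoeff_mul] at hlc
  have hdvd : (theta q G).leadingCoeff ∣ (theta q V).leadingCoeff := by
    apply hθ.dvd_of_dvd_mul_right
    exact ⟨-(theta q U).leadingCoeff, by linear_combination hlc⟩
  have h1 := natDegree_le_of_dvd hdvd (leadingCoeff_ne_zero.2 hVθ)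
  have h2 := theta_lc_natDegree_le q V
  have h3 := (natDegree_lt_iff_degree_lt hV0).2 hV
  omega

lemma lin_count {M A : Type*} [AddCommGroup M] [Module K M] [AddCommGroup A] [Module K A]
    [Module.Finite K A] (W W1 W2 : Submodule K M) [Module.Finite K W] [Module.Finite K W1]
    [Module.Finite K W2] (π : M →ₗ[K] A) (f g : M →ₗ[K] M)
    (h : ∀ F ∈ W, π F = 0 → ∃ U ∈ W1, ∃ V ∈ W2, F = f U + g V) :
    Module.finrank K W ≤ Module.finrank K A + (Module.finrank K W1 + Module.finrank K W2) := by
  let T : W →ₗ[K] A := π.comp W.subtype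
  let L : (W1 × W2) →ₗ[K] M := (f.comp W1.subtype).coprod (g.comp W2.subtype)
  have hle : (LinearMap.ker T).map W.subtype ≤ LinearMap.range L := by
    rintro F ⟨⟨F', hF'⟩, hFk, rfl⟩
    obtain ⟨U, hU, V, hV, h'⟩ := h F' hF' hFk
    exact ⟨(⟨U, hU⟩, ⟨V, hV⟩), h'.symm⟩
  have h1 := LinearMap.finrank_range_add_finrank_ker T
  have h2 : Module.finrank K (LinearMap.range T) ≤ Module.finrank K A := Submodule.finrank_le _
  have h3 : Module.finrank K (LinearMap.ker T) ≤ Module.finrank K (LinearMap.range L) := by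
    rw [LinearEquiv.finrank_eq (Submodule.equivMapOfInjective _
      W.injective_subtype (LinearMap.ker T))]
    exact Submodule.finrank_mono hle
  have h4 := LinearMap.finrank_range_le L
  rw [Module.finrank_prod] at h4
  omega

theorem lower_bound {A : Type*} [CommRing A] [Algebra K A] [Module.Finite K A]
    (π : K[X][X] →ₐ[K] A) (q : ℕ) (G H : K[X][X]) (hG : G ≠ 0) (hH : H ≠ 0)
    (hker : ∀ F, π F = 0 → ∃ U V, F = U * G + V * H)
    (hc : IsCoprime G.leadingCoeff H.leadingCoeff)
    (hθ : IsCoprime (theta q G).leadingCoeff (theta q H).leadingCoeff)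
    (hs : (theta q G).leadingCoeff.natDegree = G.natDegree)
    (ht : (theta q H).leadingCoeff.natDegree = H.natDegree) :
    H.natDegree * (theta q G).natDegree + G.natDegree * (theta q H).natDegree
      ≤ Module.finrank K A + q * G.natDegree * H.natDegree := by
  set s := G.natDegree with hsdef
  set t := H.natDegree with htdef
  set e := (theta q G).natDegree with he
  set f := (theta q H).natDegree with hf
  have hGθ : theta q G ≠ 0 := fun h => hG (theta_inj q h)
  have hHθ : theta q H ≠ 0 := fun h => hH (theta_inj q h)
  let N := e + f + q * (s + t)
  have h5 := lin_count (K := K) (Wsp K q (s + t) N) (Wsp K q t (f + q * (s + t)))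
    (Wsp K q s (e + q * (s + t))) π.toLinearMap (LinearMap.mulRight K G) (LinearMap.mulRight K H)
    (by
    intro F' hF' hk
    replace hk : π F' = 0 := hk
    obtain ⟨U0, V0, h0⟩ := hker F' hk
    obtain ⟨hdeg, hN⟩ := mem_Wsp_iff.1 hF'
    obtain ⟨U, V, hU, hV, h⟩ := reduce_deg hG hH hc hdeg (U0.natDegree + 1) U0 V0 (by omega) h0
    have hVN : (theta q (V * H)).natDegree ≤ N :=
      theta_weight hG hH hθ hs hV (by rw [← h]; exact hN)
    have hUN : (theta q (U * G)).natDegree ≤ N :=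
      theta_weight hH hG hθ.symm ht hU (by rw [add_comm, ← h]; exact hN)
    have hUm : U ∈ Wsp K q t (f + q * (s + t)) := by
      rw [mem_Wsp_iff]
      refine ⟨hU, ?_⟩
      by_cases hU0 : U = 0
      · simp [hU0]
      have hUθ : theta q U ≠ 0 := fun h => hU0 (theta_inj q h)
      rw [map_mul, natDegree_mul hUθ hGθ] at hUN
      omega
    have hVm : V ∈ Wsp K q s (e + q * (s + t)) := by
      rw [mem_Wsp_iff]
      refine ⟨hV, ?_⟩
      by_cases hV0 : V = 0
      · simp [hV0]
      have hVθ : theta q V ≠ 0 := fun h => hV0 (theta_inj q h)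
      rw [map_mul, natDegree_mul hVθ hHθ] at hVN
      omega
    exact ⟨U, hUm, V, hVm, h⟩)
  have d1 := finrank_Wsp (K := K) q (s + t) N (by omega)
  have d2 := finrank_Wsp (K := K) q t (f + q * (s + t)) (by nlinarith)
  have d3 := finrank_Wsp (K := K) q s (e + q * (s + t)) (by nlinarith)
  simp only [N] at d1 h5
  nlinarith [d1, d2, d3, h5]

end theta

section Pdef
variable {K : Type*} [Field K]

/-- The polynomial `P`. -/
noncomputable def Ppoly (K : Type*) [Field K] (q l : ℕ) : K[X][X] :=
  (X + C (X ^ q)) ^ l + X ^ l + C X * ((X + 1) ^ l + X ^ l)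

/-- The polynomial `E`. -/
noncomputable def Epoly (K : Type*) [Field K] (l : ℕ) : K[X] := (X + 1) ^ l + X ^ l

lemma Ppoly_coeff (q l k : ℕ) :
    (Ppoly K q l).coeff k = (X ^ q) ^ (l - k) * (l.choose k : K[X]) + (if k = l then 1 else 0)
      + X * ((l.choose k : K[X]) + (if k = l then 1 else 0)) := by
  rw [Ppoly, coeff_add, coeff_add, coeff_C_mul, coeff_add, coeff_X_add_C_pow, coeff_X_add_one_pow,
    coeff_X_pow]

lemma Epoly_coeff (l k : ℕ) :
    (Epoly K l).coeff k = (l.choose k : K) + (if k = l then 1 else 0) := by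
  rw [Epoly, coeff_add, coeff_X_add_one_pow, coeff_X_pow]

variable [CharP K 2]

lemma odd_cast {R : Type*} [CommRing R] [CharP R 2] {l : ℕ} (h : Odd l) : (l : R) = 1 := by
  obtain ⟨m, rfl⟩ := h
  have h2 : (2 : R) = 0 := CharTwo.two_eq_zero
  push_cast
  rw [h2]; simp

lemma Ppoly_coeff_ge (q l k : ℕ) (h : l ≤ k) : (Ppoly K q l).coeff k = 0 := by
  have h2 : (2 : K[X]) = 0 := CharTwo.two_eq_zero
  rw [Ppoly_coeff]
  rcases h.eq_or_lt with rfl | h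
  · simp
    linear_combination (1 + X) * h2
  · rw [Nat.choose_eq_zero_of_lt h, if_neg (by omega)]; simp

lemma Epoly_coeff_ge (l k : ℕ) (h : l ≤ k) : (Epoly K l).coeff k = 0 := by
  have h2 : (2 : K) = 0 := CharTwo.two_eq_zero
  rw [Epoly_coeff]
  rcases h.eq_or_lt with rfl | h
  · simp
    linear_combination h2
  · rw [Nat.choose_eq_zero_of_lt h, if_neg (by omega)]; simp

lemma Ppoly_coeff_lt (q l k : ℕ) (h : k < l) :
    (Ppoly K q l).coeff k = X ^ (q * (l - k)) * (l.choose k : K[X]) + X * (l.choose k : K[X]) := by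
  rw [Ppoly_coeff, if_neg (by omega), pow_mul]; simp

lemma Ppoly_coeff_top (q m : ℕ) (h : Even m) :
    (Ppoly K q (m + 1)).coeff m = X ^ q + X := by
  rw [Ppoly_coeff_lt _ _ _ (by omega)]
  have : (((m + 1).choose m : ℕ) : K[X]) = 1 := by
    rw [Nat.choose_succ_self_right]; exact odd_cast h.add_one
  rw [this]; simp

lemma Epoly_natDegree (m : ℕ) (h : Even m) : (Epoly K (m + 1)).natDegree = m := by
  apply le_antisymm
  · rw [natDegree_le_iff_coeff_eq_zero]
    intro k hk
    exact Epoly_coeff_ge _ _ hk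
  · apply le_natDegree_of_ne_zero
    rw [Epoly_coeff, if_neg (by omega), Nat.choose_succ_self_right, odd_cast h.add_one]
    simp

lemma XqX_ne {q : ℕ} (hq : 2 ≤ q) : (X ^ q + X : K[X]) ≠ 0 := by
  intro h
  have := congrArg (fun p => p.coeff q) h
  simp [coeff_X, show 1 ≠ q by omega] at this

lemma Ppoly_natDegree (q m : ℕ) (hq : 2 ≤ q) (h : Even m) :
    (Ppoly K q (m + 1)).natDegree = m := by
  apply le_antisymm
  · rw [natDegree_le_iff_coeff_eq_zero]
    intro k hk
    exact Ppoly_coeff_ge _ _ _ hk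
  · apply le_natDegree_of_ne_zero
    rw [Ppoly_coeff_top _ _ h]
    exact XqX_ne hq

lemma Ppoly_lc (q m : ℕ) (hq : 2 ≤ q) (h : Even m) :
    (Ppoly K q (m + 1)).leadingCoeff = X ^ q + X := by
  rw [leadingCoeff, Ppoly_natDegree q m hq h, Ppoly_coeff_top _ _ h]

lemma XqX_sep {q : ℕ} (hq : Even q) : (X ^ q + X : K[X]).Separable := by
  rw [separable_def]
  have : derivative (X ^ q + X : K[X]) = 1 := by
    have : (q : K) = 0 := by
      obtain ⟨r, rfl⟩ := hq
      have h2 : (2 : K) = 0 := CharTwo.two_eq_zero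
      push_cast; linear_combination (r : K) * h2
    simp [derivative_X_pow, this]
  rw [this]; exact isCoprime_one_right

lemma Epoly_derivative (m : ℕ) (h : Even m) :
    derivative (Epoly K (m + 1)) = (X + 1) ^ m + X ^ m := by
  have h1 : ((m + 1 : ℕ) : K) = 1 := odd_cast h.add_one
  have h2 : (((m + 1 : ℕ) : K[X])) = 1 := odd_cast h.add_one
  rw [Epoly, derivative_add, derivative_X_pow, derivative_pow, h1]
  simp

lemma Epoly_sep (m : ℕ) (hm : 0 < m) (h : Even m) : (Epoly K (m + 1)).Separable := by
  rw [separable_def, Epoly_derivative m h]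
  have h2 : (2 : K[X]) = 0 := CharTwo.two_eq_zero
  have e1 : Epoly K (m + 1) = X ^ m + ((X + 1) ^ m + X ^ m) * (X + 1) := by
    rw [Epoly]; linear_combination (- X ^ m) * h2
  rw [e1]
  apply IsCoprime.add_mul_left_left
  apply IsCoprime.pow_left
  obtain ⟨n, rfl⟩ : ∃ n, m = n + 1 := ⟨m - 1, by omega⟩
  rw [pow_succ' X n]
  apply IsCoprime.add_mul_left_right
  apply IsCoprime.pow_right
  exact ⟨-1, 1, by ring⟩

lemma theta_Ppoly_coeff_top (q m : ℕ) (hq : 2 ≤ q) :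
    (theta q (Ppoly K q (m + 1))).coeff (q * (m + 1)) = Epoly K (m + 1) := by
  ext k
  rw [theta_coeff]
  by_cases hk : m + 1 ≤ k
  · rw [Ppoly_coeff_ge _ _ _ hk, Epoly_coeff_ge _ _ hk]; simp
  · push Not at hk
    have h1 : q * k ≤ q * (m + 1) := Nat.mul_le_mul_left _ hk.le
    have h3 : q * (m + 1) - q * k = q * (m + 1 - k) := by rw [Nat.mul_sub]
    have h4 : 1 ≠ q * (m + 1 - k) := by
      have : 1 ≤ m + 1 - k := by omega
      nlinarith
    rw [if_pos h1, Ppoly_coeff_lt _ _ _ hk, Epoly_coeff, if_neg (by omega), h3, coeff_add,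
      ← C_eq_natCast, coeff_mul_C, coeff_mul_C, coeff_X_pow, coeff_X, if_neg h4]
    simp

lemma theta_Ppoly_coeff_gt (q m n : ℕ) (hq : 2 ≤ q) (hn : q * (m + 1) < n) :
    (theta q (Ppoly K q (m + 1))).coeff n = 0 := by
  ext k
  rw [theta_coeff]
  by_cases hk : m + 1 ≤ k
  · rw [Ppoly_coeff_ge _ _ _ hk]; simp
  · push Not at hk
    have h1 : q * k ≤ q * (m + 1) := Nat.mul_le_mul_left _ hk.le
    have h3 : q * (m + 1) - q * k = q * (m + 1 - k) := by rw [Nat.mul_sub]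
    have h4 : 1 < q * (m + 1 - k) := by
      have : 1 ≤ m + 1 - k := by omega
      nlinarith
    rw [if_pos (by omega), Ppoly_coeff_lt _ _ _ hk, coeff_add,
      ← C_eq_natCast, coeff_mul_C, coeff_mul_C, coeff_X_pow, coeff_X, if_neg (by omega),
      if_neg (by omega)]
    simp

lemma theta_Ppoly_natDegree (q m : ℕ) (hq : 2 ≤ q) (h : Even m) :
    (theta q (Ppoly K q (m + 1))).natDegree = q * (m + 1) := by
  apply le_antisymm
  · rw [natDegree_le_iff_coeff_eq_zero]
    intro k hk
    exact theta_Ppoly_coeff_gt _ _ _ hq hk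
  · apply le_natDegree_of_ne_zero
    rw [theta_Ppoly_coeff_top _ _ hq]
    intro h0
    have : (Epoly K (m + 1)).coeff m = 0 := by rw [h0]; simp
    rw [Epoly_coeff, if_neg (by omega), Nat.choose_succ_self_right, odd_cast h.add_one] at this
    simp at this

lemma theta_Ppoly_lc (q m : ℕ) (hq : 2 ≤ q) (h : Even m) :
    (theta q (Ppoly K q (m + 1))).leadingCoeff = Epoly K (m + 1) := by
  rw [leadingCoeff, theta_Ppoly_natDegree q m hq h, theta_Ppoly_coeff_top _ _ hq]

lemma C_dvd_of_dvd {R : Type*} [CommRing R] {a b : R} (h : a ∣ b) : C a ∣ C b := by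
  obtain ⟨c, rfl⟩ := h
  rw [C_mul]
  exact dvd_mul_right _ _

lemma Phi_exists (q l : ℕ) (hq : 0 < q) : ∃ Φ : K[X][X], C (X ^ 2 + X) * Φ = Ppoly K q l := by
  have h2 : (2 : K[X][X]) = 0 := CharTwo.two_eq_zero
  have hd1 : C X ∣ Ppoly K q l := by
    rw [Ppoly]
    apply dvd_add _ (dvd_mul_right _ _)
    have := sub_dvd_pow_sub_pow (X + C (X ^ q) : K[X][X]) X l
    have e : (X + C (X ^ q) : K[X][X]) - X = C (X ^ q) := by ring
    rw [e] at this
    have e2 : (X + C (X ^ q) : K[X][X]) ^ l - X ^ l = (X + C (X ^ q)) ^ l + X ^ l := by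
      linear_combination (-X ^ l) * h2
    rw [e2] at this
    refine dvd_trans ?_ this
    exact C_dvd_of_dvd (dvd_pow_self X (by omega))
  have hd2 : C (X + 1) ∣ Ppoly K q l := by
    have e : Ppoly K q l = ((X + C (X ^ q)) ^ l - (X + 1) ^ l)
        + C (X + 1) * ((X + 1) ^ l + X ^ l) := by
      rw [Ppoly]; simp only [map_add, map_one]; ring
    rw [e]
    apply dvd_add _ (dvd_mul_right _ _)
    refine dvd_trans ?_ (sub_dvd_pow_sub_pow _ _ _)
    have e1 : (X + C (X ^ q) : K[X][X]) - (X + 1) = C (X ^ q - 1 ^ q) := by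
      simp
    rw [e1]
    apply C_dvd_of_dvd
    refine dvd_trans ?_ (sub_dvd_pow_sub_pow _ _ _)
    have h2 : (2 : K[X]) = 0 := CharTwo.two_eq_zero
    have : (X + 1 : K[X]) = X - 1 := by linear_combination h2
    rw [this]
  have hc : IsCoprime (C X : K[X][X]) (C (X + 1)) := by
    refine ⟨-1, 1, ?_⟩
    simp only [map_add, map_one]
    ring
  obtain ⟨Φ, hΦ⟩ := hc.mul_dvd hd1 hd2
  refine ⟨Φ, ?_⟩
  rw [hΦ, ← C_mul]; ring_nf

end Pdef

section main
variable {K : Type*} [Field K] [CharP K 2]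

lemma even_cast {R : Type*} [CommRing R] [CharP R 2] {l : ℕ} (h : Even l) : (l : R) = 0 := by
  obtain ⟨m, rfl⟩ := h
  have h2 : (2 : R) = 0 := CharTwo.two_eq_zero
  push_cast
  linear_combination (m : R) * h2

lemma dZ_pow_zero {F : K[X][X]} (h : dZ F = 0) (n : ℕ) : dZ (F ^ n) = 0 := by
  induction n with
  | zero => rw [pow_zero, ← C_1, dZ_C]; simp
  | succ n ih => rw [pow_succ, dZ_mul, ih, h]; simp

lemma dZ_Ppoly (q l : ℕ) (hq : Even q) : dZ (Ppoly K q l) = (Epoly K l).map C := by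
  have h1 : dZ ((X + C (X ^ q) : K[X][X]) ^ l) = 0 := by
    apply dZ_pow_zero
    rw [dZ_add, dZ_X, dZ_C, derivative_X_pow, even_cast hq]; simp
  have h2 : dZ ((X : K[X][X]) ^ l) = 0 := dZ_pow_zero dZ_X l
  have h3 : dZ ((X + 1 : K[X][X]) ^ l) = 0 := by
    apply dZ_pow_zero
    rw [dZ_add, dZ_X, ← C_1, dZ_C]; simp
  rw [Ppoly, dZ_add, dZ_add, dZ_mul, dZ_add, h1, h2, h3, dZ_C, Epoly]
  simp

lemma derivative_Ppoly (q m : ℕ) (h : Even m) : derivative (Ppoly K q (m + 1)) =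
    (X + C (X ^ q)) ^ m + X ^ m + C X * ((X + 1) ^ m + X ^ m) := by
  have h1 : ((m + 1 : ℕ) : K[X]) = 1 := odd_cast h.add_one
  rw [Ppoly, derivative_add, derivative_add, derivative_X_pow, derivative_pow, derivative_C_mul,
    derivative_add (f := (X + 1) ^ (m + 1)), derivative_X_pow, derivative_pow, h1,
    derivative_add (f := X) (g := C (X ^ q)), derivative_C]
  simp

lemma common_zero {B : Type*} [CommRing B] (ρ : K[X][X] →+* B) (q m : ℕ) (hq : Even q)
    (G H : K[X][X]) (hGH : C (X ^ 2 + X) * (G * H) = Ppoly K q (m + 1))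
    (hG : ρ G = 0) (hH : ρ H = 0) :
    ρ (Ppoly K q (m + 1)) = 0 ∧ ρ (derivative (Ppoly K q (m + 1))) = 0 ∧
    ρ ((Epoly K (m + 1)).map C) = 0 ∧
    ρ ((derivative (Epoly K (m + 1))).map C) = ρ (C (X ^ 2 + X)) *
      (ρ (dZ G) * ρ (derivative H) - ρ (derivative G) * ρ (dZ H)) := by
  have h2 : (2 : B) = 0 := by
    have h2' : (2 : K[X][X]) = 0 := CharTwo.two_eq_zero
    have := congrArg ρ h2'
    rwa [map_ofNat, map_zero] at this
  have hd : derivative (X ^ 2 + X : K[X]) = 1 := by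
    have : (2 : K[X]) = 0 := CharTwo.two_eq_zero
    rw [derivative_add, derivative_X_sq, derivative_X]
    have e : C (2 : K) = (2 : K[X]) := map_ofNat C 2
    rw [e, this]; simp
  have hdz : (Epoly K (m + 1)).map C = G * H + C (X ^ 2 + X) * (dZ G * H + G * dZ H) := by
    rw [← dZ_Ppoly q (m + 1) hq, ← hGH, dZ_mul, dZ_mul, dZ_C, hd]; simp
  refine ⟨?_, ?_, ?_, ?_⟩
  · rw [← hGH]; simp [hG]
  · rw [← hGH, derivative_C_mul, derivative_mul]; simp [hG, hH]
  · rw [hdz]; simp only [map_add, map_mul, hG, hH]; ring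
  · rw [← derivative_map, hdz, derivative_add, derivative_C_mul, derivative_add,
      derivative_mul, derivative_mul, derivative_mul]
    simp only [map_add, map_mul, hG, hH]
    linear_combination (ρ (C (X ^ 2)) + ρ (C X)) * (ρ (derivative G) * ρ (dZ H)) * h2

/-- Case of constant `Y`-degree. -/
lemma degree_pos [IsAlgClosed K] (q m : ℕ) (hq : 2 ≤ q) (hqe : Even q) (hm : 0 < m) (hme : Even m)
    (G H : K[X][X]) (hGH : C (X ^ 2 + X) * (G * H) = Ppoly K q (m + 1))
    (hG : ¬ IsUnit G) : 0 < G.natDegree := by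
  by_contra h0
  have h0 : G.natDegree = 0 := by omega
  obtain ⟨g, rfl⟩ : ∃ g, G = C g := ⟨_, eq_C_of_natDegree_eq_zero h0⟩
  have hg : ¬ IsUnit g := fun h => hG (isUnit_C.2 h)
  have hP0 : Ppoly K q (m + 1) ≠ 0 := by
    intro h
    have := Ppoly_lc (K := K) q m hq hme
    rw [h, leadingCoeff_zero] at this
    exact XqX_ne hq this.symm
  have hg0 : g ≠ 0 := by
    rintro rfl
    apply hP0; rw [← hGH]; simp
  obtain ⟨ζ, hζ⟩ := IsAlgClosed.exists_root g (fun h => hg (isUnit_iff_degree_eq_zero.2 h))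
  have hζ0 : g.eval ζ = 0 := hζ
  have hlc : (X ^ 2 + X) * (g * H.leadingCoeff) = (X ^ q + X : K[X]) := by
    rw [← Ppoly_lc (K := K) q m hq hme, ← hGH, leadingCoeff_mul, leadingCoeff_mul, leadingCoeff_C,
      leadingCoeff_C]
  have hcf : ∀ k, ((Ppoly K q (m + 1)).coeff k).eval ζ = 0 := by
    intro k
    rw [← hGH, coeff_C_mul, coeff_C_mul]; simp [hζ0]
  have c0 := hcf 0
  have c1 := hcf 1
  have c2 := hcf m
  rw [Ppoly_coeff_lt _ _ _ (by omega)] at c0 c1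
  rw [Ppoly_coeff_top _ _ hme] at c2
  rw [Nat.choose_zero_right] at c0
  rw [Nat.choose_one_right, odd_cast hme.add_one] at c1
  simp [pow_mul] at c0 c1 c2
  have c2' : ζ ^ q = ζ := by
    have h2 : (2 : K) = 0 := CharTwo.two_eq_zero
    linear_combination c2 - ζ * h2
  rw [c2'] at c0 c1
  have c3 : ζ ^ 2 + ζ = 0 := by
    have h2 : (2 : K) = 0 := CharTwo.two_eq_zero
    linear_combination c0 - ζ * c1 + ζ ^ 2 * h2
  have hs := XqX_sep (K := K) hqe
  rw [← hlc] at hs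
  obtain ⟨a, b, hab⟩ := hs.isCoprime
  have := congrArg (eval ζ) hab
  simp [hζ0, c3] at this

lemma zeros_eq [IsAlgClosed K] (q m : ℕ) (hq : 2 ≤ q) (hqe : Even q) (hm : 0 < m) (hme : Even m)
    (G H : K[X][X]) (hGH : C (X ^ 2 + X) * (G * H) = Ppoly K q (m + 1)) (z y : K)
    (hG : evalEval z y G = 0) (hH : evalEval z y H = 0) :
    z ≠ 0 ∧ z ≠ 1 ∧ (Epoly K (m + 1)).eval y = 0 ∧ (y + z ^ q) ^ (m + 1) = y ^ (m + 1) ∧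
    z ^ q + (y + 1) * z ^ (q - 1) + y = 0 := by
  have h2 : (2 : K) = 0 := CharTwo.two_eq_zero
  have hE : ∀ p : K[X], evalEvalRingHom z y (p.map C) = p.eval y := by
    intro p
    simp [evalEvalRingHom, evalEval, eval_map, eval₂_at_apply]
  obtain ⟨h1, h3, h4, h5⟩ := common_zero (evalEvalRingHom z y) q m hqe G H hGH hG hH
  rw [hE] at h4 h5
  obtain ⟨a, b, hab⟩ := Epoly_sep (K := K) m hm hme
  have h6 : (z ^ 2 + z) ≠ 0 := by
    intro h0
    have := congrArg (eval y) hab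
    rw [eval_add, eval_mul, eval_mul, h4, h5] at this
    simp [evalEval, h0] at this
  have hz0 : z ≠ 0 := by rintro rfl; simp at h6
  have hz1 : z ≠ 1 := by rintro rfl; apply h6; linear_combination h2
  rw [derivative_Ppoly _ _ hme] at h3
  rw [Ppoly] at h1
  simp [evalEval] at h1 h3
  have h4' := h4
  simp [Epoly] at h4'
  rw [h4', mul_zero, add_zero] at h1
  have e1 : (y + 1) ^ (m + 1) = y ^ (m + 1) := by linear_combination h4' - y ^ (m + 1) * h2
  have e2 : (y + z ^ q) ^ (m + 1) = y ^ (m + 1) := by linear_combination h1 - y ^ (m + 1) * h2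
  refine ⟨hz0, hz1, h4, e2, ?_⟩
  have hy : y ≠ 0 := by rintro rfl; simp at e1
  obtain ⟨r, rfl⟩ : ∃ r, q = r + 1 := ⟨q - 1, by omega⟩
  simp only [Nat.add_sub_cancel]
  have hmul : y ^ (m + 1) * z * (z ^ (r + 1) + (y + 1) * z ^ r + y) = 0 := by
    have : y * (y + 1) * (y + z ^ (r + 1)) * ((y + z ^ (r + 1)) ^ m + y ^ m
      + z * ((y + 1) ^ m + y ^ m)) = 0 := by rw [h3]; ring
    have e3 : y * (y + 1) * ((y + z ^ (r + 1)) ^ (m + 1)) + (y + 1) * (y + z ^ (r + 1)) * y ^ (m + 1)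
        + z * (y * (y + z ^ (r + 1)) * (y + 1) ^ (m + 1) + (y + 1) * (y + z ^ (r + 1)) * y ^ (m + 1))
        = 0 := by
      linear_combination this
    rw [e1, e2] at e3
    linear_combination e3 - y ^ (m + 1) * (y ^ 2 + y + z * y * (y + z ^ (r + 1))) * h2
  rcases mul_eq_zero.1 hmul with h | h
  · exact absurd h (mul_ne_zero (pow_ne_zero _ hy) hz0)
  · exact h

lemma card_bound (E : K[X]) (hE : E ≠ 0) (c : ℕ) (T : K → Finset K) (hT : ∀ y, (T y).card ≤ c) :
    ∃ S : Finset (K × K), S.card ≤ E.natDegree * c ∧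
      ∀ z y, E.eval y = 0 → z ∈ T y → (z, y) ∈ S := by
  classical
  refine ⟨E.roots.toFinset.biUnion fun y => (T y).image fun z => (z, y), ?_, ?_⟩
  · refine (Finset.card_biUnion_le_card_mul _ _ c ?_).trans ?_
    · intro y _
      exact Finset.card_image_le.trans (hT y)
    · apply Nat.mul_le_mul_right
      exact (Multiset.toFinset_card_le _).trans (card_roots' E)
  · intro z y hy hz
    simp only [Finset.mem_biUnion, Finset.mem_image, Multiset.mem_toFinset]
    exact ⟨y, (mem_roots hE).2 hy, z, hz, rfl⟩

/-- The finite set of possible common zeros. -/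
lemma zeros_card [IsAlgClosed K] (i m : ℕ) (hi : 0 < i) (hm : 0 < m) (hme : Even m)
    (G H : K[X][X]) (hGH : C (X ^ 2 + X) * (G * H) = Ppoly K (2 ^ i) (m + 1)) :
    ∃ S : Finset (K × K), S.card ≤ m * (if m = 2 then 1 else 2 ^ i - 1) ∧
      ∀ z y, evalEval z y G = 0 → evalEval z y H = 0 → (z, y) ∈ S := by
  classical
  have h2 : (2 : K) = 0 := CharTwo.two_eq_zero
  have hq : 2 ≤ 2 ^ i := by
    calc 2 = 2 ^ 1 := rfl
      _ ≤ 2 ^ i := Nat.pow_le_pow_right (by norm_num) hi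
  have hqe : Even (2 ^ i) := (Nat.even_pow' (by omega)).2 (by decide)
  have hE0 : Epoly K (m + 1) ≠ 0 := by
    intro h
    have := Epoly_natDegree (K := K) m hme
    rw [h] at this; simp at this; omega
  have hZ := zeros_eq (2 ^ i) m hq hqe hm hme G H hGH
  by_cases hm2 : m = 2
  · rw [if_pos hm2]
    have hroot : ∀ y : K, ∃ z0 : K, z0 ^ (2 ^ i) = y + 1 := fun y =>
      IsAlgClosed.exists_pow_nat_eq (y + 1) (by positivity)
    choose r hr using hroot
    obtain ⟨S, hS, hS'⟩ := card_bound (Epoly K (m + 1)) hE0 1 (fun y => {r y}) (fun y => by simp)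
    refine ⟨S, by rwa [Epoly_natDegree m hme] at hS, ?_⟩
    intro z y hG hH
    obtain ⟨hz0, hz1, hy, h3, -⟩ := hZ z y hG hH
    apply hS' z y hy
    rw [Finset.mem_singleton]
    subst hm2
    simp [Epoly] at hy
    have hinj : ∀ a b : K, a ^ (2 ^ i) = b ^ (2 ^ i) → a = b := by
      intro a b hab
      have : (a - b) ^ (2 ^ i) = 0 := by rw [sub_pow_char_pow, hab, sub_self]
      exact sub_eq_zero.1 (pow_eq_zero_iff (by positivity) |>.1 this)
    have hw0 : z ^ (2 ^ i) ≠ 0 := pow_ne_zero _ hz0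
    have hw1 : z ^ (2 ^ i) ≠ 1 := by
      intro h; apply hz1; apply hinj; rw [h]; simp
    apply hinj
    rw [hr]
    generalize z ^ (2 ^ i) = w at *
    have hy2 : y ^ 2 + y + 1 = 0 := by linear_combination hy - (y ^ 3 + y ^ 2 + y) * h2
    have hw : w * ((w - 1) * (w - (y + 1))) = 0 := by
      linear_combination h3 + w * hy2 - (2 * y * w ^ 2 + w ^ 2 + 2 * y ^ 2 * w) * h2
    rcases mul_eq_zero.1 hw with h | h
    · exact absurd h hw0
    rcases mul_eq_zero.1 h with h | h
    · exact absurd (sub_eq_zero.1 h) hw1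
    · exact sub_eq_zero.1 h
  · rw [if_neg hm2]
    let R : K → K[X] := fun y => X ^ (2 ^ i) + (C (y + 1) * X ^ (2 ^ i - 1) + C y)
    have hRm : ∀ y, (C (y + 1) * X ^ (2 ^ i - 1) + C y : K[X]).degree < (2 ^ i : ℕ) := by
      intro y
      refine lt_of_le_of_lt (degree_add_le _ _) (max_lt ?_ ?_)
      · refine lt_of_le_of_lt (degree_C_mul_X_pow_le _ _) ?_
        exact_mod_cast (by omega)
      · refine lt_of_le_of_lt degree_C_le ?_
        exact_mod_cast (by omega)
    have hmon : ∀ y, (R y).Monic := fun y => monic_X_pow_add (hRm y)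
    have hnd : ∀ y, (R y).natDegree = 2 ^ i := by
      intro y
      apply natDegree_eq_of_degree_eq_some
      exact degree_add_eq_left_of_degree_lt (by rw [degree_X_pow]; exact hRm y) |>.trans
        (degree_X_pow _)
    obtain ⟨S, hS, hS'⟩ := card_bound (Epoly K (m + 1)) hE0 (2 ^ i - 1)
      (fun y => (R y).roots.toFinset.erase 1) (fun y => by
        rw [Finset.card_erase_of_mem]
        · apply Nat.sub_le_sub_right
          refine (Multiset.toFinset_card_le _).trans ((card_roots' _).trans (hnd y).le)
        · rw [Multiset.mem_toFinset, mem_roots (hmon y).ne_zero, IsRoot.def]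
          simp [R]
          linear_combination (1 + y) * h2)
    refine ⟨S, by rwa [Epoly_natDegree m hme] at hS, ?_⟩
    intro z y hG hH
    obtain ⟨hz0, hz1, hy, h3, h4⟩ := hZ z y hG hH
    apply hS' z y hy
    rw [Finset.mem_erase, Multiset.mem_toFinset, mem_roots (hmon y).ne_zero, IsRoot.def]
    refine ⟨hz1, ?_⟩
    simp [R]
    linear_combination h4

lemma exists_quot.{u, v} {K : Type u} {R : Type v} [Field K] [CommRing R] [Algebra K R] (G H : R) :
    ∃ (A : Type v) (_ : CommRing A) (_ : Algebra K A) (π : R →ₐ[K] A), Function.Surjective π ∧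
      π G = 0 ∧ π H = 0 ∧ ∀ F, π F = 0 → ∃ U V, F = U * G + V * H := by
  refine ⟨R ⧸ Ideal.span {G, H}, inferInstance, inferInstance, Ideal.Quotient.mkₐ K _,
    Ideal.Quotient.mkₐ_surjective K _, ?_, ?_, ?_⟩
  · exact Ideal.Quotient.eq_zero_iff_mem.2 (Ideal.subset_span (by simp))
  · exact Ideal.Quotient.eq_zero_iff_mem.2 (Ideal.subset_span (by simp))
  · intro F hF
    have := Ideal.Quotient.eq_zero_iff_mem.1 hF
    obtain ⟨a, b, h⟩ := Ideal.mem_span_pair.1 this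
    exact ⟨a, b, h.symm⟩

lemma arith_contra (q s t e f c : ℕ) (hs : 0 < s) (ht : 0 < t) (he : q * s ≤ e) (hf : q * t ≤ f)
    (hq : 2 ≤ q) (hme : Even (s + t))
    (hef : e + f + 2 = q * (s + t + 1)) (hno : ¬ (q = 2 ∧ s + t = 2))
    (hc : c ≤ (s + t) * (if s + t = 2 then 1 else q - 1))
    (hlow : t * e + s * f ≤ c + q * s * t) : False := by
  obtain ⟨a, rfl⟩ := Nat.exists_eq_add_of_le he
  obtain ⟨b, rfl⟩ := Nat.exists_eq_add_of_le hf
  have hab : a + b + 2 = q := by nlinarith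
  split_ifs at hc with h
  · have : s = 1 := by omega
    have : t = 1 := by omega
    subst s t
    simp at *
    omega
  · have h3 : 4 ≤ s + t := by
      obtain ⟨r, hr⟩ := hme; omega
    have hst : s + t ≤ s * t + 1 := by nlinarith
    have hta : a ≤ t * a := Nat.le_mul_of_pos_left _ ht
    have hsb : b ≤ s * b := Nat.le_mul_of_pos_left _ hs
    obtain ⟨r, rfl⟩ : ∃ r, q = r + 1 := ⟨q - 1, by omega⟩
    simp only [Nat.add_sub_cancel] at hc
    have h5 : (r + 1) * (s + t) ≤ (r + 1) * (s * t + 1) := Nat.mul_le_mul_left _ hst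
    nlinarith

theorem Phi_irreducible [IsAlgClosed K] (i m : ℕ) (hi : 0 < i) (hm : 0 < m) (hme : Even m)
    (hno : ¬ (i = 1 ∧ m = 2)) (Φ : K[X][X]) (hΦ : C (X ^ 2 + X) * Φ = Ppoly K (2 ^ i) (m + 1)) :
    Irreducible Φ := by
  have hq : 2 ≤ 2 ^ i := by
    calc 2 = 2 ^ 1 := rfl
      _ ≤ 2 ^ i := Nat.pow_le_pow_right (by norm_num) hi
  have hqe : Even (2 ^ i) := (Nat.even_pow' (by omega)).2 (by decide)
  have hno' : ¬ (2 ^ i = 2 ∧ m = 2) := by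
    rintro ⟨h1, h2⟩
    exact hno ⟨Nat.pow_right_injective le_rfl (by simpa using h1), h2⟩
  have hP0 : Ppoly K (2 ^ i) (m + 1) ≠ 0 := by
    intro h
    have := Ppoly_lc (K := K) _ m hq hme
    rw [h, leadingCoeff_zero] at this
    exact XqX_ne hq this.symm
  have hΦ0 : Φ ≠ 0 := by rintro rfl; apply hP0; rw [← hΦ]; simp
  have hXX : (X ^ 2 + X : K[X]) ≠ 0 := XqX_ne le_rfl
  have hΦd : Φ.natDegree = m := by
    have := Ppoly_natDegree (K := K) _ m hq hme
    rwa [← hΦ, natDegree_C_mul hXX] at this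
  refine ⟨fun h => ?_, ?_⟩
  · have := natDegree_eq_zero_of_isUnit h
    omega
  intro G H hGH
  subst hGH
  by_contra hcon
  push Not at hcon
  obtain ⟨hGu, hHu⟩ := hcon
  have hs := degree_pos _ m hq hqe hm hme G H hΦ hGu
  have ht := degree_pos _ m hq hqe hm hme H G (by rw [mul_comm H G]; exact hΦ) hHu
  have hG0 : G ≠ 0 := left_ne_zero_of_mul hΦ0
  have hH0 : H ≠ 0 := right_ne_zero_of_mul hΦ0
  have hst : G.natDegree + H.natDegree = m := by rw [← hΦd, natDegree_mul hG0 hH0]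
  have hc : IsCoprime G.leadingCoeff H.leadingCoeff := by
    have h1 := Ppoly_lc (K := K) _ m hq hme
    rw [← hΦ, leadingCoeff_mul, leadingCoeff_mul, leadingCoeff_C] at h1
    have h3 := XqX_sep (K := K) hqe
    rw [← h1] at h3
    exact h3.of_mul_right.isCoprime
  set q := 2 ^ i with hqdef
  have hGθ : theta q G ≠ 0 := fun h => hG0 (theta_inj q h)
  have hHθ : theta q H ≠ 0 := fun h => hH0 (theta_inj q h)
  have hmon : ((X ^ 2 + X : K[X]).map (C : K →+* K[X])).Monic := by
    apply Monic.map
    exact monic_X_pow_add (by rw [degree_X]; exact_mod_cast (by omega))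
  have hmond : ((X ^ 2 + X : K[X]).map (C : K →+* K[X])).natDegree = 2 := by
    rw [natDegree_map_eq_of_injective C_injective]
    compute_degree!
  have hθP := congrArg (theta q) hΦ
  rw [map_mul, map_mul, theta_C] at hθP
  have hlc : (theta q G).leadingCoeff * (theta q H).leadingCoeff = Epoly K (m + 1) := by
    rw [← theta_Ppoly_lc q m hq hme, ← hθP, leadingCoeff_mul, leadingCoeff_mul, hmon.leadingCoeff,
      one_mul]
  have hdeg : (theta q G).natDegree + (theta q H).natDegree + 2 = q * (m + 1) := by
    rw [← theta_Ppoly_natDegree (K := K) q m hq hme, ← hθP, natDegree_mul hmon.ne_zero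
      (mul_ne_zero hGθ hHθ), natDegree_mul hGθ hHθ, hmond, add_comm]
  have hθ : IsCoprime (theta q G).leadingCoeff (theta q H).leadingCoeff := by
    have := Epoly_sep (K := K) m hm hme
    rw [← hlc] at this
    exact this.isCoprime
  have hsum : (theta q G).leadingCoeff.natDegree + (theta q H).leadingCoeff.natDegree = m := by
    rw [← natDegree_mul (leadingCoeff_ne_zero.2 hGθ) (leadingCoeff_ne_zero.2 hHθ), hlc,
      Epoly_natDegree m hme]
  have hle1 := theta_lc_natDegree_le q G
  have hle2 := theta_lc_natDegree_le q H
  have hsG : (theta q G).leadingCoeff.natDegree = G.natDegree := by omega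
  have hsH : (theta q H).leadingCoeff.natDegree = H.natDegree := by omega
  have hwt : ∀ F : K[X][X], theta q F ≠ 0 → (theta q F).leadingCoeff.natDegree = F.natDegree →
      q * F.natDegree ≤ (theta q F).natDegree := by
    intro F hF h
    by_contra hlt
    have h1 := theta_coeff q F (theta q F).natDegree F.natDegree
    rw [if_neg hlt, coeff_natDegree, ← h, coeff_natDegree] at h1
    exact hF (leadingCoeff_eq_zero.1 (leadingCoeff_eq_zero.1 h1))
  have he := hwt G hGθ hsG
  have hf := hwt H hHθ hsH
  obtain ⟨S, hScard, hS⟩ := zeros_card i m hi hm hme G H hΦ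
  obtain ⟨A, _, _, π, hπ, hπG, hπH, hker⟩ := exists_quot (K := K) G H
  obtain ⟨-, -, h4, h5⟩ := common_zero (π : K[X][X] →+* A) q m hqe G H hΦ hπG hπH
  obtain ⟨a, b, hab⟩ := Epoly_sep (K := K) m hm hme
  have hJ : π (b.map C * C (X ^ 2 + X)) *
      (π (dZ G) * π (derivative H) - π (derivative G) * π (dZ H)) = 1 := by
    have h6 := congrArg (fun p => (π : K[X][X] →+* A) (p.map C)) hab
    simp only [Polynomial.map_add, Polynomial.map_mul, map_add, map_mul, h4, h5, mul_zero,
      zero_add, Polynomial.map_one, map_one] at h6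
    rw [map_mul, mul_assoc]
    rw [map_add C]
    rw [map_add π]
    exact h6
  obtain ⟨hfin, hrank⟩ := finrank_le_aux π hπ G H _ hπG hπH hJ S hS
  have hlow := lower_bound π q G H hG0 hH0 hker hc hθ hsG hsH
  rw [← hst] at hdeg hScard hno' hme
  exact arith_contra q _ _ _ _ _ hs ht he hf hq hme hdeg hno' (hrank.trans hScard) hlow

end main
end aux

section transfer
open Polynomial
variable {K : Type*} [Field K]

/-- Substitution `x = Y + Z ^ q`, `y = Y + 1`, `z = Y`. -/
noncomputable def psi (q : ℕ) : MvPolynomial (Fin 3) K →+* K[X][X] :=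
  MvPolynomial.eval₂Hom (C.comp C) ![X + C (X ^ q), X + 1, X]

/-- Substitution `x = X`, `y = 1`, `z = 0`. -/
noncomputable def gam : MvPolynomial (Fin 3) K →+* K[X] :=
  MvPolynomial.eval₂Hom C ![X, 1, 0]

/-- Substitution `x = 1`, `y = X`, `z = 0`. -/
noncomputable def bet : MvPolynomial (Fin 3) K →+* K[X] :=
  MvPolynomial.eval₂Hom C ![1, X, 0]

/-- Scaling by a new variable. -/
noncomputable def scal : MvPolynomial (Fin 3) K →+* (MvPolynomial (Fin 3) K)[X] :=
  MvPolynomial.eval₂Hom (C.comp MvPolynomial.C) (fun i => C (MvPolynomial.X i) * X)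

lemma psi_eval_zero (q : ℕ) (g : MvPolynomial (Fin 3) K) :
    (psi q g).eval 0 = expand K q (gam g) := by
  induction g using MvPolynomial.induction_on with
  | C a => simp [psi, gam]
  | add p r hp hr => rw [map_add, map_add, map_add, eval_add, hp, hr]
  | mul_X p i hp =>
    rw [map_mul, map_mul, map_mul, eval_mul, hp]
    congr 1
    fin_cases i <;> simp [psi, gam]

lemma gam_eval (g : MvPolynomial (Fin 3) K) (t : K) :
    (gam g).eval t = MvPolynomial.eval ![t, 1, 0] g := by
  induction g using MvPolynomial.induction_on with
  | C a => simp [gam]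
  | add p r hp hr => rw [map_add, map_add, eval_add, hp, hr]
  | mul_X p i hp =>
    rw [map_mul, map_mul, eval_mul, hp]
    congr 1
    fin_cases i <;> simp [gam]

lemma bet_eval (g : MvPolynomial (Fin 3) K) (t : K) :
    (bet g).eval t = MvPolynomial.eval ![1, t, 0] g := by
  induction g using MvPolynomial.induction_on with
  | C a => simp [bet]
  | add p r hp hr => rw [map_add, map_add, eval_add, hp, hr]
  | mul_X p i hp =>
    rw [map_mul, map_mul, eval_mul, hp]
    congr 1
    fin_cases i <;> simp [bet]

lemma scal_eval_one (g : MvPolynomial (Fin 3) K) : (scal g).eval 1 = g := by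
  induction g using MvPolynomial.induction_on with
  | C a => simp [scal]
  | add p r hp hr => rw [map_add, eval_add, hp, hr]
  | mul_X p i hp =>
    rw [map_mul, eval_mul, hp]
    simp [scal]

lemma scal_eval (g : MvPolynomial (Fin 3) K) (t : K) (p : Fin 3 → K) :
    MvPolynomial.eval p ((scal g).eval (MvPolynomial.C t)) = MvPolynomial.eval (fun i => t * p i) g := by
  induction g using MvPolynomial.induction_on with
  | C a => simp [scal]
  | add p r hp hr => rw [map_add, eval_add, map_add, map_add, hp, hr]
  | mul_X p i hp =>
    rw [map_mul, eval_mul, map_mul, map_mul, hp]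
    congr 1
    simp only [scal, MvPolynomial.eval₂Hom_X', eval_mul, eval_C, eval_X, map_mul,
      MvPolynomial.eval_X, MvPolynomial.eval_C]
    ring

lemma monomial_of_mul {R : Type*} [CommRing R] [IsDomain R] {a b : R[X]} {c : R} {d : ℕ}
    (hc : c ≠ 0) (h : a * b = C c * X ^ d) : ∃ r e, a = C r * X ^ e := by
  have h0 : a * b ≠ 0 := by rw [h]; simp [hc]
  have ha : a ≠ 0 := left_ne_zero_of_mul h0
  have hb : b ≠ 0 := right_ne_zero_of_mul h0
  have h1 : a.natDegree + b.natDegree = d := by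
    rw [← natDegree_mul ha hb, h, natDegree_C_mul_X_pow d c hc]
  have h2 : a.natTrailingDegree + b.natTrailingDegree = d := by
    rw [← natTrailingDegree_mul ha hb, h, C_mul_X_pow_eq_monomial, natTrailingDegree_monomial hc]
  have h3 := natTrailingDegree_le_natDegree a
  have h4 := natTrailingDegree_le_natDegree b
  refine ⟨a.leadingCoeff, a.natDegree, ?_⟩
  ext n
  rw [coeff_C_mul_X_pow]
  split_ifs with hn
  · rw [hn, coeff_natDegree]
  · rcases lt_or_gt_of_ne hn with hn | hn
    · exact coeff_eq_zero_of_lt_natTrailingDegree (by omega)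
    · exact coeff_eq_zero_of_natDegree_lt hn

lemma scal_phi {j : ℕ} (hj : 2 ≤ j) {φ : MvPolynomial (Fin 3) K}
    (hφ : denom K * φ = numerMon K j) (hd : denom K ≠ 0) : scal φ = C φ * X ^ (j - 2) := by
  have h1 : scal (denom K) = C (denom K) * X ^ 3 := by
    simp only [denom, map_mul, map_add, scal, MvPolynomial.eval₂Hom_X']; ring
  have h2 : scal (numerMon K j) = C (numerMon K j) * X ^ (j + 1) := by
    simp only [numerMon, map_mul, map_add, map_pow, scal, MvPolynomial.eval₂Hom_X']; ring
  have h3 := congrArg scal hφ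
  rw [map_mul, h1, h2, ← hφ, C_mul] at h3
  have h4 : (C (denom K) * X ^ 3 : (MvPolynomial (Fin 3) K)[X]) ≠ 0 := by simp [hd]
  apply mul_left_cancel₀ h4
  rw [h3, show j + 1 = 3 + (j - 2) by omega, pow_add]; ring

lemma homog_factor {j : ℕ} (hj : 2 ≤ j) {φ g h : MvPolynomial (Fin 3) K}
    (hφ : denom K * φ = numerMon K j) (hd : denom K ≠ 0) (hφ0 : φ ≠ 0) (hgh : φ = g * h) :
    ∃ e : ℕ, ∀ (t : K) (p : Fin 3 → K),
      MvPolynomial.eval (fun i => t * p i) g = t ^ e * MvPolynomial.eval p g := by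
  have h1 := scal_phi hj hφ hd
  have h2 : scal g * scal h = C φ * X ^ (j - 2) := by rw [← map_mul, ← hgh, h1]
  obtain ⟨r, e, hre⟩ := monomial_of_mul hφ0 h2
  have h3 := scal_eval_one g
  rw [hre] at h3
  simp at h3
  rw [h3] at hre
  refine ⟨e, fun t p => ?_⟩
  rw [← scal_eval, hre, eval_mul, eval_C, eval_pow, eval_X, map_mul, map_pow,
    MvPolynomial.eval_C, mul_comm]

lemma denom_ne_zero : denom K ≠ 0 := by
  have hx : ∀ i k : Fin 3, i ≠ k → (MvPolynomial.X i + MvPolynomial.X k : MvPolynomial (Fin 3) K) ≠ 0 := by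
    intro i k hik h
    have := congrArg (MvPolynomial.eval (Pi.single i (1 : K))) h
    simp [hik.symm] at this
  exact mul_ne_zero (mul_ne_zero (hx _ _ (by decide)) (hx _ _ (by decide))) (hx _ _ (by decide))

lemma bet_phi {j : ℕ} (hj : 0 < j) {φ : MvPolynomial (Fin 3) K}
    (hφ : denom K * φ = numerMon K j) : (1 + X) * X * bet φ = X ^ j + X := by
  have := congrArg bet hφ
  rw [map_mul] at this
  have h1 : bet (denom K) = (1 + X) * X := by
    simp [denom, bet]
  have h2 : bet (numerMon K j) = X ^ j + X := by
    simp [numerMon, bet, show j ≠ 0 by omega]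
  rw [← h1, ← h2, this]

lemma bet_phi_zero {j : ℕ} (hj : 2 ≤ j) {φ : MvPolynomial (Fin 3) K}
    (hφ : denom K * φ = numerMon K j) : (bet φ).eval 0 = 1 := by
  have h := bet_phi (by omega) hφ
  obtain ⟨r, rfl⟩ : ∃ r, j = r + 2 := ⟨j - 2, by omega⟩
  have h2 : (1 + X) * bet φ = X ^ (r + 1) + 1 := by
    apply mul_left_cancel₀ (X_ne_zero (R := K))
    linear_combination h
  have := congrArg (eval 0) h2
  simpa using this

lemma const_of_gam [Infinite K] {j : ℕ} (hj : 2 ≤ j) {φ g h : MvPolynomial (Fin 3) K}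
    (hφ : denom K * φ = numerMon K j) (hφ0 : φ ≠ 0) (hgh : φ = g * h) (c : K)
    (hg : gam g = C c) : IsUnit g := by
  obtain ⟨e, he⟩ := homog_factor hj hφ denom_ne_zero hφ0 hgh
  have hb : X * (bet g - C c * X ^ e) = 0 := by
    apply Polynomial.funext
    intro s
    by_cases hs : s = 0
    · simp [hs]
    have h1 := he s ![s⁻¹, 1, 0]
    rw [← gam_eval, hg] at h1
    have h2 : (fun i => s * (![s⁻¹, 1, 0] : Fin 3 → K) i) = ![1, s, 0] := by
      funext i; fin_cases i <;> simp [hs]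
    rw [h2, ← bet_eval] at h1
    rw [eval_mul, eval_sub, h1]
    simp
    right; ring
  have hb' : bet g = C c * X ^ e := by
    rcases mul_eq_zero.1 hb with h | h
    · exact absurd h X_ne_zero
    · exact sub_eq_zero.1 h
  have he0 : e = 0 := by
    by_contra hne
    have h1 := bet_phi_zero hj hφ
    rw [hgh, map_mul, hb'] at h1
    simp [hne] at h1
  have hgc : g = MvPolynomial.C (MvPolynomial.eval 0 g) := by
    apply MvPolynomial.funext
    intro p
    have h1 := he 0 p
    rw [he0] at h1
    simp only [zero_mul, pow_zero, one_mul] at h1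
    rw [MvPolynomial.eval_C, ← h1]; rfl
  have hg0 : g ≠ 0 := by rintro rfl; apply hφ0; rw [hgh]; simp
  rw [hgc]
  apply IsUnit.map
  rw [isUnit_iff_ne_zero]
  intro h0
  rw [h0] at hgc
  exact hg0 (by rw [hgc]; simp)

lemma not_unit {j : ℕ} (hj : 3 ≤ j) {φ : MvPolynomial (Fin 3) K}
    (hφ : denom K * φ = numerMon K j) : ¬ IsUnit φ := by
  intro hu
  have h := bet_phi (by omega) hφ
  obtain ⟨c, -, hc⟩ := Polynomial.isUnit_iff.1 (hu.map bet)
  rw [← hc] at h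
  have := congrArg (fun p => p.coeff j) h
  simp only [coeff_add, coeff_X_pow, coeff_X] at this
  have e : ((1 + X) * X * C c : K[X]).coeff j = 0 := by
    apply coeff_eq_zero_of_natDegree_lt
    refine lt_of_le_of_lt (b := 2) ?_ (by omega)
    compute_degree!
  rw [e, if_neg (by omega : ¬ 1 = j)] at this
  simp at this

variable [CharP K 2]

lemma psi_phi (i l : ℕ) {φ : MvPolynomial (Fin 3) K}
    (hφ : denom K * φ = numerMon K (2 ^ i * l)) (Φ : K[X][X])
    (hΦ : C (X ^ 2 + X) * Φ = Ppoly K (2 ^ i) l) : psi (2 ^ i) φ = Φ ^ (2 ^ i) := by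
  have h2 : (2 : K[X][X]) = 0 := CharTwo.two_eq_zero
  have h1 : psi (2 ^ i) (denom K) = C (X ^ 2 + X) ^ (2 ^ i) := by
    rw [← C_pow, add_pow_char_pow]
    simp only [denom, map_mul, map_add, psi, MvPolynomial.eval₂Hom_X', Matrix.cons_val_zero,
      Matrix.cons_val_one, Matrix.cons_val]
    rw [← pow_mul, mul_comm 2, pow_mul (X : K[X])]
    generalize (X : K[X]) ^ 2 ^ i = w
    rw [C_pow]
    linear_combination (4 * X ^ 3 + 4 * X ^ 2 * C w + X * C w ^ 2 + 4 * X ^ 2 + 3 * X * C w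
      + X) * h2
  have h3 : psi (2 ^ i) (numerMon K (2 ^ i * l)) = Ppoly K (2 ^ i) l ^ (2 ^ i) := by
    rw [Ppoly, add_pow_char_pow, add_pow_char_pow, mul_pow, add_pow_char_pow]
    simp only [← pow_mul, mul_comm l]
    simp only [numerMon, map_mul, map_add, map_pow, psi, MvPolynomial.eval₂Hom_X',
      Matrix.cons_val_zero, Matrix.cons_val_one, Matrix.cons_val]
    linear_combination (X * ((X + C X ^ 2 ^ i) ^ (2 ^ i * l) + (X + 1) ^ (2 ^ i * l)
      + X ^ (2 ^ i * l))) * h2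
  have h4 := congrArg (psi (2 ^ i)) hφ
  rw [map_mul, h1, h3, ← hΦ, mul_pow] at h4
  have hne : (C (X ^ 2 + X) : K[X][X]) ^ (2 ^ i) ≠ 0 := by
    apply pow_ne_zero
    rw [Ne, C_eq_zero]
    exact XqX_ne le_rfl
  exact mul_left_cancel₀ hne h4

theorem phi_irreducible [IsAlgClosed K] (i m : ℕ) (hi : 0 < i) (hm : 0 < m) (hme : Even m)
    (hno : ¬ (i = 1 ∧ m = 2)) {φ : MvPolynomial (Fin 3) K}
    (hφ : denom K * φ = numerMon K (2 ^ i * (m + 1))) : Irreducible φ := by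
  classical
  have : Infinite K := IsAlgClosed.instInfinite
  have : Fact (Nat.Prime 2) := ⟨Nat.prime_two⟩
  have hq : 2 ≤ 2 ^ i := by
    calc 2 = 2 ^ 1 := rfl
      _ ≤ 2 ^ i := Nat.pow_le_pow_right (by norm_num) hi
  have hqe : Even (2 ^ i) := (Nat.even_pow' (by omega)).2 (by decide)
  have hj : 3 ≤ 2 ^ i * (m + 1) := by
    have : 2 * (m + 1) ≤ 2 ^ i * (m + 1) := Nat.mul_le_mul_right _ hq
    omega
  obtain ⟨Φ, hΦ⟩ := Phi_exists (K := K) (2 ^ i) (m + 1) (by positivity)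
  have hirr := Phi_irreducible i m hi hm hme hno Φ hΦ
  have hψ := psi_phi i (m + 1) hφ Φ hΦ
  -- the specialization
  have hu : (X ^ 2 + X) * Φ.eval 0 = (X ^ (2 ^ i * (m + 1)) + X : K[X]) := by
    have := congrArg (eval 0) hΦ
    rw [eval_mul, eval_C] at this
    rw [this, Ppoly]
    simp [pow_mul]
  have hsep : ((X ^ 2 + X) * Φ.eval 0 : K[X]).Separable := by
    rw [hu]; exact XqX_sep (hqe.mul_right _)
  have hu0 : Φ.eval 0 ≠ 0 := by
    intro h
    rw [h, mul_zero] at hu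
    exact XqX_ne (by omega) hu.symm
  obtain ⟨α, hα⟩ := IsAlgClosed.exists_root (Φ.eval 0) (by
    intro h
    have h1 : ((X ^ 2 + X) * Φ.eval 0 : K[X]).natDegree = 2 := by
      rw [natDegree_mul (XqX_ne le_rfl) hu0, natDegree_eq_of_degree_eq_some h]
      have : (X ^ 2 + X : K[X]).natDegree = 2 := by compute_degree!
      rw [this]; rfl
    have h3 : (X ^ (2 ^ i * (m + 1)) + X : K[X]).natDegree = 2 ^ i * (m + 1) := by
      apply natDegree_eq_of_degree_eq_some
      rw [degree_add_eq_left_of_degree_lt, degree_X_pow]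
      rw [degree_X, degree_X_pow]
      exact_mod_cast (by omega)
    rw [hu, h3] at h1
    omega)
  have hmult : rootMultiplicity α (Φ.eval 0) = 1 := by
    apply le_antisymm
    · exact rootMultiplicity_le_one_of_separable hsep.of_mul_right α
    · exact (rootMultiplicity_pos hu0).2 hα
  have hφ0 : φ ≠ 0 := by
    rintro rfl
    rw [map_zero] at hψ
    exact pow_ne_zero _ hirr.ne_zero hψ.symm
  have hunit : ∀ g h : MvPolynomial (Fin 3) K, φ = g * h →
      rootMultiplicity α ((psi (2 ^ i) g).eval 0) = 0 → IsUnit g := by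
    intro g h hgh hg
    have hdvd : psi (2 ^ i) g ∣ Φ ^ (2 ^ i) := by
      rw [← hψ, hgh, map_mul]; exact dvd_mul_right _ _
    obtain ⟨a, -, ha⟩ := (dvd_prime_pow hirr.prime _).1 hdvd
    obtain ⟨w, hw⟩ := ha.symm
    have h1 : (psi (2 ^ i) g).eval 0 = (Φ.eval 0) ^ a * (w : K[X][X]).eval 0 := by
      rw [← hw, eval_mul, eval_pow]
    have hne : (psi (2 ^ i) g).eval 0 ≠ 0 := by
      rw [h1]
      apply mul_ne_zero (pow_ne_zero _ hu0)
      exact (w.isUnit.map (evalRingHom (0 : K[X]))).ne_zero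
    have ha0 : a = 0 := by
      by_contra hane
      have h3 : (psi (2 ^ i) g).eval 0 |>.IsRoot α := by
        rw [IsRoot.def, h1, eval_mul, eval_pow, hα.eq_zero, zero_pow hane, zero_mul]
      have := (rootMultiplicity_pos hne).2 h3
      omega
    rw [ha0, pow_zero, one_mul] at h1
    have h4 : IsUnit ((psi (2 ^ i) g).eval 0) := by
      rw [h1]; exact w.isUnit.map (evalRingHom (0 : K[X]))
    rw [psi_eval_zero] at h4
    obtain ⟨c, -, hc⟩ := Polynomial.isUnit_iff.1 h4
    exact const_of_gam (by omega) hφ hφ0 hgh c ((expand_eq_C (by positivity)).1 hc.symm)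
  refine ⟨not_unit hj hφ, ?_⟩
  intro g h hgh
  have hprod : (psi (2 ^ i) g).eval 0 * (psi (2 ^ i) h).eval 0 = (Φ.eval 0) ^ (2 ^ i) := by
    rw [← eval_mul, ← map_mul, ← hgh, hψ, eval_pow]
  have hne : (psi (2 ^ i) g).eval 0 * (psi (2 ^ i) h).eval 0 ≠ 0 := by
    rw [hprod]; exact pow_ne_zero _ hu0
  have hm1 := rootMultiplicity_mul (x := α) hne
  rw [hprod, ← count_roots, roots_pow, Multiset.count_nsmul, count_roots, hmult] at hm1
  have hmg : 2 ^ i ∣ rootMultiplicity α ((psi (2 ^ i) g).eval 0) := by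
    rw [psi_eval_zero, rootMultiplicity_expand_pow]; exact dvd_mul_right _ _
  have hmh : 2 ^ i ∣ rootMultiplicity α ((psi (2 ^ i) h).eval 0) := by
    rw [psi_eval_zero, rootMultiplicity_expand_pow]; exact dvd_mul_right _ _
  rcases Nat.eq_zero_or_pos (rootMultiplicity α ((psi (2 ^ i) g).eval 0)) with h0 | h0
  · exact Or.inl (hunit g h hgh h0)
  · right
    apply hunit h g (by rw [hgh, mul_comm])
    have := Nat.le_of_dvd h0 hmg
    omega

end transfer

/-- For `j` even and positive, not `6` and not a power of two, the polynomial
`φ_j` has an absolutely irreducible factor over `F_2`. -/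
theorem phi_hasAbsIrredFactor (j : ℕ) (hj : Even j) (hj0 : 0 < j) (h6 : j ≠ 6)
    (hpow : ∀ i : ℕ, j ≠ 2 ^ i) (φ : MvPolynomial (Fin 3) (ZMod 2))
    (hφ : denom (ZMod 2) * φ = numerMon (ZMod 2) j) :
    HasAbsIrredFactor (ZMod 2) φ := by
  obtain ⟨i, l, hl, rfl⟩ := Nat.exists_eq_two_pow_mul_odd hj0.ne'
  obtain ⟨r, rfl⟩ := hl
  have hr : 0 < r := by
    rcases Nat.eq_zero_or_pos r with rfl | h
    · exact absurd (by simp) (hpow i)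
    · exact h
  have hi : 0 < i := by
    rcases Nat.eq_zero_or_pos i with rfl | h
    · rw [pow_zero, one_mul] at hj
      exact absurd hj (by simp)
    · exact h
  have hno : ¬ (i = 1 ∧ 2 * r = 2) := by
    rintro ⟨rfl, h⟩
    have : r = 1 := by omega
    subst this
    exact h6 rfl
  have : CharP (AlgebraicClosure (ZMod 2)) 2 := inferInstance
  set f := algebraMap (ZMod 2) (AlgebraicClosure (ZMod 2)) with hf
  have hφK : denom (AlgebraicClosure (ZMod 2)) * MvPolynomial.map f φ
      = numerMon (AlgebraicClosure (ZMod 2)) (2 ^ i * (2 * r + 1)) := by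
    have := congrArg (MvPolynomial.map f) hφ
    rw [map_mul] at this
    have h1 : MvPolynomial.map f (denom (ZMod 2)) = denom (AlgebraicClosure (ZMod 2)) := by
      simp [denom]
    have h2 : MvPolynomial.map f (numerMon (ZMod 2) (2 ^ i * (2 * r + 1)))
        = numerMon (AlgebraicClosure (ZMod 2)) (2 ^ i * (2 * r + 1)) := by
      simp [numerMon]
    rwa [h1, h2] at this
  have hirr := phi_irreducible i (2 * r) hi (by omega) (even_two_mul r) hno hφK
  refine ⟨φ, dvd_rfl, ?_, hirr⟩
  rw [Nat.pos_iff_ne_zero]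
  intro h0
  rw [MvPolynomial.totalDegree_eq_zero_iff_eq_C] at h0
  rw [h0, MvPolynomial.map_C] at hirr
  by_cases hc : f (MvPolynomial.coeff 0 φ) = 0
  · rw [hc, map_zero] at hirr
    exact hirr.ne_zero rfl
  · exact hirr.not_isUnit ((isUnit_iff_ne_zero.2 hc).map MvPolynomial.C)
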